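/- Let ρ be a finite signed Borel measure on ℝ³ with total variation measure |ρ|, and let V(x) = ∫_{ℝ³} ‖x − y‖⁻¹ dρ(y) (which is well defined for almost every x ∈ ℝ³). Then for every Schwartz function Ψ : ℝ³ → ℂ⁴ one has (∫_{ℝ³} |V(x)|²·‖Ψ(x)‖²_{ℂ⁴} dx)^{1/2} ≤ 2·|ρ|(ℝ³) · (Σ_{k=1}^{3} ∫_{ℝ³} ‖(∂_k Ψ)(x)‖²_{ℂ⁴} dx)^{1/2}. -/

import Mathlib

noncomputable section
open MeasureTheory

/-- Physical space `ℝ³`. -/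
abbrev Space := EuclideanSpace ℝ (Fin 3)

/-- Spinor space `ℂ⁴` with its Euclidean (ℓ²) norm. -/
abbrev Spinor := EuclideanSpace ℂ (Fin 4)

/-- The Pauli matrices `σ₁, σ₂, σ₃`. -/
def pauli : Fin 3 → Matrix (Fin 2) (Fin 2) ℂ
  | 0 => !![0, 1; 1, 0]
  | 1 => !![0, -Complex.I; Complex.I, 0]
  | 2 => !![1, 0; 0, -1]

/-- The Dirac matrices `α_k = [[0, σ_k], [σ_k, 0]]` in `2×2` block form. -/
def diracAlpha (k : Fin 3) : Matrix (Fin 4) (Fin 4) ℂ :=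
  Matrix.reindex finSumFinEquiv finSumFinEquiv
    (Matrix.fromBlocks 0 (pauli k) (pauli k) 0)

/-- The Dirac matrix `β = [[I₂, 0], [0, −I₂]]` in `2×2` block form. -/
def diracBeta : Matrix (Fin 4) (Fin 4) ℂ :=
  Matrix.reindex finSumFinEquiv finSumFinEquiv
    (Matrix.fromBlocks (1 : Matrix (Fin 2) (Fin 2) ℂ) 0 0
      (-1 : Matrix (Fin 2) (Fin 2) ℂ))

/-- Action of a `4×4` complex matrix on a spinor. -/
def matVec (A : Matrix (Fin 4) (Fin 4) ℂ) (v : Spinor) : Spinor :=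
  (WithLp.equiv 2 (Fin 4 → ℂ)).symm (A.mulVec ((WithLp.equiv 2 (Fin 4 → ℂ)) v))

/-- The partial derivative `∂_k Ψ` of a Schwartz function `Ψ : ℝ³ → ℂ⁴`,
evaluated at `x`. -/
def partialDer (Ψ : SchwartzMap Space Spinor) (k : Fin 3) (x : Space) : Spinor :=
  fderiv ℝ Ψ x (EuclideanSpace.single k 1)

/-- The free Dirac operator: `(D₀Ψ)(x) = −i·Σ_k α_k (∂_k Ψ)(x) + β·Ψ(x)`. -/
def diracOp (Ψ : SchwartzMap Space Spinor) (x : Space) : Spinor :=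
  (-Complex.I) • (∑ k : Fin 3, matVec (diracAlpha k) (partialDer Ψ k x)) +
    matVec diracBeta (Ψ x)

/-- The Coulomb potential `V(x) = ∫ ‖x−y‖⁻¹ dρ(y)` generated by a finite signed
Borel measure `ρ` on `ℝ³`, computed via its Jordan decomposition. -/
def coulombPotential (ρ : SignedMeasure Space) (x : Space) : ℝ :=
  (∫ y, ‖x - y‖⁻¹ ∂ρ.toJordanDecomposition.posPart) -
    (∫ y, ‖x - y‖⁻¹ ∂ρ.toJordanDecomposition.negPart)


lemma hardy_ibp_aux (Ψ : SchwartzMap Space Spinor) (y : Space) (ε : ℝ) (hε : 0 < ε) (k : Fin 3) :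
    Integrable (fun x : Space => (1 / (‖x - y‖^2 + ε) - 2 * (x k - y k)^2 / (‖x - y‖^2 + ε)^2) * ‖Ψ x‖^2) ∧
    Integrable (fun x : Space => ((x k - y k) / (‖x - y‖^2 + ε))^2 * ‖Ψ x‖^2) ∧
    Integrable (fun x : Space => ‖partialDer Ψ k x‖^2) ∧
    ∫ x : Space, (1 / (‖x - y‖^2 + ε) - 2 * (x k - y k)^2 / (‖x - y‖^2 + ε)^2) * ‖Ψ x‖^2 ≤
      ∫ x : Space, (1/2 * (((x k - y k) / (‖x - y‖^2 + ε))^2 * ‖Ψ x‖^2) + 2 * ‖partialDer Ψ k x‖^2) := by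
  have hR : ∀ x : Space, 0 < ‖x - y‖^2 + ε := fun x => by positivity
  have hu : ∀ x : Space, (x k - y k)^2 ≤ ‖x - y‖^2 := fun x => by
    rw [EuclideanSpace.norm_sq_eq]
    have := Finset.single_le_sum (f := fun i => ‖(x - y) i‖^2) (fun i _ => by positivity)
      (Finset.mem_univ k)
    simpa using this
  have hcu : Continuous (fun x : Space => x k - y k) := by fun_prop
  have hcR : Continuous (fun x : Space => ‖x - y‖^2 + ε) := by fun_prop
  have hcf : Continuous (fun x : Space => (x k - y k) / (‖x - y‖^2 + ε)) :=
    hcu.div hcR fun x => (hR x).ne'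
  have hcf' : Continuous (fun x : Space =>
      1 / (‖x - y‖^2 + ε) - 2 * (x k - y k)^2 / (‖x - y‖^2 + ε)^2) :=
    (continuous_const.div hcR fun x => (hR x).ne').sub
      ((continuous_const.mul (hcu.pow 2)).div (hcR.pow 2) fun x => (pow_pos (hR x) 2).ne')
  have hbf : ∀ x : Space, ‖(x k - y k) / (‖x - y‖^2 + ε)‖ ≤ 1 / ε + 1 := fun x => by
    rw [norm_div, Real.norm_eq_abs, Real.norm_eq_abs, abs_of_pos (hR x), div_le_iff₀ (hR x)]
    have h1 : (1 / ε + 1) * (‖x - y‖^2 + ε) = ‖x - y‖^2 / ε + 1 + ‖x - y‖^2 + ε := by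
      field_simp
      ring
    rw [h1]
    have h2 : 0 ≤ ‖x - y‖^2 / ε := by positivity
    have h3 := sq_abs (x k - y k)
    nlinarith [hu x, sq_nonneg (|x k - y k| - 1)]
  have hbf' : ∀ x : Space,
      ‖1 / (‖x - y‖^2 + ε) - 2 * (x k - y k)^2 / (‖x - y‖^2 + ε)^2‖ ≤ 3 / ε := fun x => by
    have h1 : 1 / (‖x - y‖^2 + ε) ≤ 1 / ε :=
      one_div_le_one_div_of_le hε (by nlinarith [sq_nonneg ‖x - y‖])
    have h0 : 0 ≤ 1 / (‖x - y‖^2 + ε) := by positivity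
    have h2 : 2 * (x k - y k)^2 / (‖x - y‖^2 + ε)^2 ≤ 2 * (1 / (‖x - y‖^2 + ε)) := by
      rw [div_le_iff₀ (by positivity)]
      have : 2 * (1 / (‖x - y‖^2 + ε)) * (‖x - y‖^2 + ε)^2 = 2 * (‖x - y‖^2 + ε) := by
        have := (hR x).ne'
        field_simp
      rw [this]
      linarith [hu x]
    have h3 : 0 ≤ 2 * (x k - y k)^2 / (‖x - y‖^2 + ε)^2 := by positivity
    have h4 : 3 / ε = 3 * (1 / ε) := by ring
    rw [Real.norm_eq_abs, abs_le, h4]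
    constructor <;> linarith
  have hΨ2 : Integrable (fun x : Space => ‖Ψ x‖^2) :=
    (memLp_two_iff_integrable_sq_norm Ψ.continuous.aestronglyMeasurable).1 (Ψ.memLp 2)
  let D : SchwartzMap Space Spinor := LineDeriv.lineDerivOp (EuclideanSpace.single k (1:ℝ)) Ψ
  have hD : ∀ x, D x = partialDer Ψ k x := fun x => rfl
  have hDc : Continuous (fun x => partialDer Ψ k x) := D.continuous
  have hD2 : Integrable (fun x : Space => ‖partialDer Ψ k x‖^2) :=
    (memLp_two_iff_integrable_sq_norm D.continuous.aestronglyMeasurable).1 (D.memLp 2)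
  let g' : Space → ℝ := fun x => 2 * RCLike.re (inner ℂ (Ψ x) (partialDer Ψ k x))
  have hg'c : Continuous g' := by
    have := Ψ.continuous
    exact continuous_const.mul (RCLike.continuous_re.comp (this.inner hDc))
  have hg'b : ∀ x, ‖g' x‖ ≤ 2 * (‖Ψ x‖ * ‖partialDer Ψ k x‖) := fun x => by
    simp only [g', norm_mul, Real.norm_ofNat]
    gcongr
    exact (RCLike.norm_re_le_norm _).trans (norm_inner_le_norm _ _)
  have hg'i : Integrable g' := by
    refine (hΨ2.add hD2).mono' hg'c.aestronglyMeasurable (ae_of_all _ fun x => ?_)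
    refine (hg'b x).trans ?_
    simp only [Pi.add_apply]
    nlinarith [sq_nonneg (‖Ψ x‖ - ‖partialDer Ψ k x‖)]
  have hI1 : Integrable (fun x : Space => (1 / (‖x - y‖^2 + ε) - 2 * (x k - y k)^2 / (‖x - y‖^2 + ε)^2) * ‖Ψ x‖^2) :=
    hΨ2.bdd_mul hcf'.aestronglyMeasurable (ae_of_all _ hbf')
  have hI2 : Integrable (fun x : Space => ((x k - y k) / (‖x - y‖^2 + ε))^2 * ‖Ψ x‖^2) := by
    refine hΨ2.bdd_mul (c := (1/ε+1)^2) (hcf.pow 2).aestronglyMeasurable (ae_of_all _ fun x => ?_)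
    rw [norm_pow]
    exact pow_le_pow_left₀ (norm_nonneg _) (hbf x) 2
  have hI3 : Integrable (fun x : Space => ((x k - y k) / (‖x - y‖^2 + ε)) * g' x) :=
    hg'i.bdd_mul hcf.aestronglyMeasurable (ae_of_all _ hbf)
  have hI4 : Integrable (fun x : Space => ((x k - y k) / (‖x - y‖^2 + ε)) * ‖Ψ x‖^2) :=
    hΨ2.bdd_mul hcf.aestronglyMeasurable (ae_of_all _ hbf)
  refine ⟨hI1, hI2, hD2, ?_⟩
  have key := integral_bilinear_hasLineDerivAt_right_eq_neg_left_of_integrable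
    (μ := (volume : Measure Space)) (B := ContinuousLinearMap.mul ℝ ℝ)
    (f := fun x : Space => (x k - y k) / (‖x - y‖^2 + ε))
    (f' := fun x : Space => 1 / (‖x - y‖^2 + ε) - 2 * (x k - y k)^2 / (‖x - y‖^2 + ε)^2)
    (g := fun x => ‖Ψ x‖^2) (g' := g') (v := EuclideanSpace.single k (1:ℝ))
    hI1 hI3 hI4 ?_ ?_
  · simp only [ContinuousLinearMap.mul_apply'] at key
    rw [eq_neg_iff_add_eq_zero, add_comm, ← eq_neg_iff_add_eq_zero] at key
    rw [key, ← integral_neg]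
    refine integral_mono hI3.neg ((hI2.const_mul _).add (hD2.const_mul _)) fun x => ?_
    have h1 := hg'b x
    have h2 : -((x k - y k) / (‖x - y‖^2 + ε) * g' x) ≤
        |(x k - y k) / (‖x - y‖^2 + ε)| * (2 * (‖Ψ x‖ * ‖partialDer Ψ k x‖)) := by
      refine (neg_le_abs _).trans ?_
      rw [abs_mul]
      exact mul_le_mul_of_nonneg_left h1 (abs_nonneg _)
    refine h2.trans ?_
    rw [← sq_abs ((x k - y k) / (‖x - y‖^2 + ε))]
    nlinarith [sq_nonneg (|(x k - y k) / (‖x - y‖^2 + ε)| * ‖Ψ x‖ - 2 * ‖partialDer Ψ k x‖)]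
  · intro x _
    unfold HasLineDerivAt
    have hl : HasDerivAt (fun t : ℝ => x + t • (EuclideanSpace.single k (1:ℝ) : Space) - y)
        (EuclideanSpace.single k (1:ℝ)) 0 := by
      simpa using (((hasDerivAt_id (0:ℝ)).smul_const (EuclideanSpace.single k (1:ℝ) : Space)).const_add x).sub_const y
    have hn := (hl.norm_sq).add_const ε
    have hk : HasDerivAt (fun t : ℝ => (x + t • (EuclideanSpace.single k (1:ℝ) : Space)) k - y k) 1 0 := by
      simpa using ((hasDerivAt_id (0:ℝ)).const_add (x k)).sub_const (y k)
    have := hk.div hn (by simpa using (hR x).ne')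
    convert! this using 1
    have := (hR x).ne'
    simp [EuclideanSpace.inner_single_right]
    field_simp
  · intro x _
    unfold HasLineDerivAt
    have hl : HasDerivAt (fun t : ℝ => x + t • (EuclideanSpace.single k (1:ℝ) : Space))
        (EuclideanSpace.single k (1:ℝ)) 0 := by
      simpa using ((hasDerivAt_id (0:ℝ)).smul_const (EuclideanSpace.single k (1:ℝ) : Space)).const_add x
    have hd : HasFDerivAt Ψ (fderiv ℝ Ψ x) (x + (0:ℝ) • (EuclideanSpace.single k (1:ℝ) : Space)) := by
      simpa using (Ψ.differentiableAt (x := x)).hasFDerivAt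
    have h1 := hd.comp_hasDerivAt (0:ℝ) hl
    have h2 := h1.inner ℂ h1
    have h3 := (RCLike.reCLM (K := ℂ)).hasFDerivAt.comp_hasDerivAt (0:ℝ) h2
    convert! h3 using 1
    · funext t
      simp
      rw [← Complex.ofReal_pow, Complex.ofReal_re]
    · simp only [g', partialDer, Function.comp_def, zero_smul, add_zero, map_add, RCLike.reCLM_apply]
      rw [inner_re_symm (𝕜 := ℂ) (fderiv ℝ Ψ x _)]
      ring

lemma hardy_eps (Ψ : SchwartzMap Space Spinor) (y : Space) (ε : ℝ) (hε : 0 < ε) :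
    Integrable (fun x : Space => ‖Ψ x‖^2 / (‖x - y‖^2 + ε)) ∧
    ∫ x : Space, ‖Ψ x‖^2 / (‖x - y‖^2 + ε) ≤ 4 * ∑ k : Fin 3, ∫ x, ‖partialDer Ψ k x‖ ^ 2 := by
  have hR : ∀ x : Space, 0 < ‖x - y‖^2 + ε := fun x => by positivity
  have hΨ2 : Integrable (fun x : Space => ‖Ψ x‖^2) :=
    (memLp_two_iff_integrable_sq_norm Ψ.continuous.aestronglyMeasurable).1 (Ψ.memLp 2)
  have hcR : Continuous (fun x : Space => 1 / (‖x - y‖^2 + ε)) :=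
    continuous_const.div (by fun_prop) fun x => (hR x).ne'
  have hI : Integrable (fun x : Space => ‖Ψ x‖^2 / (‖x - y‖^2 + ε)) := by
    have : Integrable (fun x : Space => 1 / (‖x - y‖^2 + ε) * ‖Ψ x‖^2) := by
      refine hΨ2.bdd_mul (c := 1 / ε) hcR.aestronglyMeasurable (ae_of_all _ fun x => ?_)
      rw [Real.norm_eq_abs, abs_of_pos (by have := hR x; positivity)]
      exact one_div_le_one_div_of_le hε (by nlinarith [sq_nonneg ‖x - y‖])
    refine this.congr (ae_of_all _ fun x => ?_)
    simp only
    ring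
  refine ⟨hI, ?_⟩
  have hk := hardy_ibp_aux Ψ y ε hε
  have h1 := fun k => (hk k).1
  have h2 := fun k => (hk k).2.1
  have h3 := fun k => (hk k).2.2.1
  have h4 : ∀ k : Fin 3, ∫ x : Space,
      ((1 / (‖x - y‖^2 + ε) - 2 * (x k - y k)^2 / (‖x - y‖^2 + ε)^2) * ‖Ψ x‖^2 -
        1/2 * (((x k - y k) / (‖x - y‖^2 + ε))^2 * ‖Ψ x‖^2)) ≤
      2 * ∫ x, ‖partialDer Ψ k x‖ ^ 2 := fun k => by
    have := (hk k).2.2.2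
    rw [integral_add ((h2 k).const_mul _) ((h3 k).const_mul _), integral_const_mul 2] at this
    rw [integral_sub (h1 k) ((h2 k).const_mul _)]
    linarith
  have h5 := Finset.sum_le_sum fun k (_ : k ∈ Finset.univ) => h4 k
  have h12 : ∀ k ∈ (Finset.univ : Finset (Fin 3)), Integrable (fun x : Space =>
      (1 / (‖x - y‖^2 + ε) - 2 * (x k - y k)^2 / (‖x - y‖^2 + ε)^2) * ‖Ψ x‖^2 -
        1/2 * (((x k - y k) / (‖x - y‖^2 + ε))^2 * ‖Ψ x‖^2)) :=
    fun k _ => (h1 k).sub ((h2 k).const_mul _)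
  rw [← Finset.mul_sum, ← integral_finsetSum _ h12] at h5
  have h6 : ∫ x : Space, 1/2 * (‖Ψ x‖^2 / (‖x - y‖^2 + ε)) ≤ ∫ x : Space, ∑ k : Fin 3,
      ((1 / (‖x - y‖^2 + ε) - 2 * (x k - y k)^2 / (‖x - y‖^2 + ε)^2) * ‖Ψ x‖^2 -
        1/2 * (((x k - y k) / (‖x - y‖^2 + ε))^2 * ‖Ψ x‖^2)) := by
    refine integral_mono (hI.const_mul _)
      (integrable_finsetSum _ h12) fun x => ?_
    have hs : ‖x - y‖^2 = ∑ k : Fin 3, (x k - y k)^2 := by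
      rw [EuclideanSpace.norm_sq_eq]
      simp
    have hx := hR x
    set R := ‖x - y‖^2 + ε with hRdef
    have hsum : ∑ k : Fin 3, ((1 / R - 2 * (x k - y k)^2 / R^2) * ‖Ψ x‖^2 -
        1/2 * (((x k - y k) / R)^2 * ‖Ψ x‖^2)) =
        (3 / R - 5/2 * (‖x - y‖^2) / R^2) * ‖Ψ x‖^2 := by
      rw [hs]
      simp only [Fin.sum_univ_three]
      ring
    simp only
    rw [hsum]
    have h7 : 1/2 * (‖Ψ x‖^2 / R) = (1/2/R) * ‖Ψ x‖^2 := by ring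
    rw [h7]
    refine mul_le_mul_of_nonneg_right ?_ (by positivity)
    have h8 : 5/2 * (‖x - y‖^2) / R^2 ≤ 5/2 / R := by
      rw [div_le_div_iff₀ (by positivity) hx]
      nlinarith
    have h9 : 1/2/R = 3/R - 5/2/R := by ring
    linarith
  rw [integral_const_mul] at h6
  linarith

open scoped ENNReal

lemma hardy_lintegral (Ψ : SchwartzMap Space Spinor) (y : Space) :
    ∫⁻ x : Space, ‖‖x - y‖⁻¹‖ₑ ^ 2 * ‖Ψ x‖ₑ ^ 2 ≤
      ENNReal.ofReal (4 * ∑ k : Fin 3, ∫ x, ‖partialDer Ψ k x‖ ^ 2) := by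
  let F : ℕ → Space → ℝ≥0∞ := fun n x =>
    ENNReal.ofReal (‖Ψ x‖^2 / (‖x - y‖^2 + 1 / ((n:ℝ) + 1)))
  have hm : ∀ n, Measurable (F n) := fun n => by
    have := Ψ.continuous.measurable
    exact ENNReal.measurable_ofReal.comp ((this.norm.pow_const 2).div
      (((measurable_id.sub_const y).norm.pow_const 2).add_const _))
  have hb : ∀ n, ∫⁻ x, F n x ≤ ENNReal.ofReal (4 * ∑ k : Fin 3, ∫ x, ‖partialDer Ψ k x‖ ^ 2) :=
    fun n => by
    have h := hardy_eps Ψ y (1 / ((n:ℝ) + 1)) (by positivity)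
    rw [← ofReal_integral_eq_lintegral_ofReal h.1 (ae_of_all _ fun x => by positivity)]
    exact ENNReal.ofReal_le_ofReal h.2
  calc _ ≤ ∫⁻ x, Filter.liminf (fun n => F n x) Filter.atTop := by
        refine lintegral_mono fun x => ?_
        by_cases hxy : x = y
        · simp [hxy]
        have hpos : 0 < ‖x - y‖ := norm_pos_iff.2 (sub_ne_zero.2 hxy)
        have ht : Filter.Tendsto (fun n => F n x) Filter.atTop
            (nhds (ENNReal.ofReal (‖Ψ x‖^2 / (‖x - y‖^2 + 0)))) :=
          (ENNReal.continuous_ofReal.tendsto _).comp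
            (tendsto_const_nhds.div (tendsto_const_nhds.add tendsto_one_div_add_atTop_nhds_zero_nat)
              (by positivity))
        rw [ht.liminf_eq]
        simp only [← ofReal_norm]
        rw [← ENNReal.ofReal_pow (norm_nonneg _), ← ENNReal.ofReal_pow (norm_nonneg _),
          ← ENNReal.ofReal_mul (by positivity)]
        apply ENNReal.ofReal_le_ofReal
        simp
        apply le_of_eq
        field_simp
    _ ≤ Filter.liminf (fun n => ∫⁻ x, F n x) Filter.atTop := lintegral_liminf_le hm
    _ ≤ Filter.liminf (fun _ : ℕ => ENNReal.ofReal (4 * ∑ k : Fin 3, ∫ x, ‖partialDer Ψ k x‖ ^ 2))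
          Filter.atTop := Filter.liminf_le_liminf (Filter.Eventually.of_forall hb)
    _ = _ := Filter.liminf_const _

lemma sq_lintegral_le_aux (μ : Measure Space) (f : Space → ℝ≥0∞) (hf : Measurable f) :
    (∫⁻ y, f y ∂μ) ^ 2 ≤ μ Set.univ * ∫⁻ y, f y ^ 2 ∂μ := by
  have h := ENNReal.lintegral_mul_le_Lp_mul_Lq μ (p := 2) (q := 2)
    Real.HolderConjugate.two_two (f := fun _ => 1) (g := f) aemeasurable_const hf.aemeasurable
  simp only [Pi.mul_apply, one_mul, ENNReal.one_rpow, lintegral_const] at h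
  calc _ ≤ (μ Set.univ ^ (1/2 : ℝ) * (∫⁻ y, f y ^ (2:ℝ) ∂μ) ^ (1/2 : ℝ)) ^ 2 := by gcongr
    _ = _ := by
      rw [mul_pow, ← ENNReal.rpow_natCast, ← ENNReal.rpow_natCast, ← ENNReal.rpow_mul,
        ← ENNReal.rpow_mul]
      norm_num

lemma enorm_coulomb_le (ρ : SignedMeasure Space) (x : Space) :
    ‖coulombPotential ρ x‖ₑ ≤ ∫⁻ y, ‖‖x - y‖⁻¹‖ₑ ∂ρ.totalVariation := by
  unfold coulombPotential SignedMeasure.totalVariation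
  rw [lintegral_add_measure]
  exact (enorm_sub_le).trans (add_le_add (enorm_integral_le_lintegral_enorm _)
    (enorm_integral_le_lintegral_enorm _))

lemma coulomb_lintegral_bound (ρ : SignedMeasure Space) (Ψ : SchwartzMap Space Spinor) :
    ∫⁻ x, ‖coulombPotential ρ x‖ₑ ^ 2 * ‖Ψ x‖ₑ ^ 2 ≤
      ρ.totalVariation Set.univ ^ 2 *
        ENNReal.ofReal (4 * ∑ k : Fin 3, ∫ x, ‖partialDer Ψ k x‖ ^ 2) := by
  set μ := ρ.totalVariation with hμ
  set C := ENNReal.ofReal (4 * ∑ k : Fin 3, ∫ x, ‖partialDer Ψ k x‖ ^ 2)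
  have hm : Measurable (fun p : Space × Space => ‖‖p.1 - p.2‖⁻¹‖ₑ) := by fun_prop
  have hΨ : Measurable (fun x : Space => ‖Ψ x‖ₑ ^ 2) := by
    have := Ψ.continuous.measurable
    fun_prop
  calc _ ≤ ∫⁻ x : Space, μ Set.univ * ∫⁻ y, ‖‖x - y‖⁻¹‖ₑ ^ 2 * ‖Ψ x‖ₑ ^ 2 ∂μ := by
        refine lintegral_mono fun x => ?_
        have hx : Measurable (fun y : Space => ‖‖x - y‖⁻¹‖ₑ) := by fun_prop
        rw [lintegral_mul_const _ (hx.pow_const 2), ← mul_assoc]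
        gcongr
        exact (pow_le_pow_left₀ (zero_le) (enorm_coulomb_le ρ x) 2).trans
          (sq_lintegral_le_aux _ _ hx)
    _ = μ Set.univ * ∫⁻ x : Space, ∫⁻ y, ‖‖x - y‖⁻¹‖ₑ ^ 2 * ‖Ψ x‖ₑ ^ 2 ∂μ :=
        lintegral_const_mul' _ _ (measure_ne_top _ _)
    _ = μ Set.univ * ∫⁻ y, (∫⁻ x : Space, ‖‖x - y‖⁻¹‖ₑ ^ 2 * ‖Ψ x‖ₑ ^ 2) ∂μ := by
        rw [lintegral_lintegral_swap]
        exact ((hm.pow_const 2).mul (hΨ.comp measurable_fst)).aemeasurable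
    _ ≤ μ Set.univ * ∫⁻ _y, C ∂μ := by
        gcongr with y
        exact hardy_lintegral Ψ y
    _ = _ := by
        rw [lintegral_const]
        ring

/-- **Hardy bound on the Coulomb potential of a finite signed measure.**
For every finite signed Borel measure `ρ` on `ℝ³` with total variation `|ρ|` and
every Schwartz function `Ψ : ℝ³ → ℂ⁴`,
`‖VΨ‖_{L²} ≤ 2·|ρ|(ℝ³)·(Σ_k ∫ ‖∂_k Ψ‖²)^{1/2}`, where `V = ρ ∗ ‖·‖⁻¹`.
This follows from Minkowski's integral inequality and Hardy's inequality. -/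
theorem coulomb_potential_hardy_bound
    (ρ : SignedMeasure Space) (Ψ : SchwartzMap Space Spinor) :
    Real.sqrt (∫ x, |coulombPotential ρ x| ^ 2 * ‖Ψ x‖ ^ 2) ≤
      2 * (ρ.totalVariation Set.univ).toReal *
        Real.sqrt (∑ k : Fin 3, ∫ x, ‖partialDer Ψ k x‖ ^ 2) := by
  set S := ∑ k : Fin 3, ∫ x, ‖partialDer Ψ k x‖ ^ 2 with hS
  have hS0 : 0 ≤ S := Finset.sum_nonneg fun k _ => integral_nonneg fun x => by positivity
  have h := coulomb_lintegral_bound ρ Ψ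
  have h1 : ‖∫ x, |coulombPotential ρ x| ^ 2 * ‖Ψ x‖ ^ 2‖ₑ ≤
      ρ.totalVariation Set.univ ^ 2 * ENNReal.ofReal (4 * S) := by
    refine (enorm_integral_le_lintegral_enorm _).trans (le_trans (le_of_eq ?_) h)
    refine lintegral_congr fun x => ?_
    simp [enorm_mul, enorm_pow]
  have h2 : ∫ x, |coulombPotential ρ x| ^ 2 * ‖Ψ x‖ ^ 2 ≤
      (ρ.totalVariation Set.univ).toReal ^ 2 * (4 * S) := by
    have h3 := ENNReal.toReal_mono (by finiteness) h1
    rw [toReal_enorm, ENNReal.toReal_mul, ENNReal.toReal_pow,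
      ENNReal.toReal_ofReal (by positivity)] at h3
    exact (Real.le_norm_self _).trans h3
  refine (Real.sqrt_le_sqrt h2).trans (le_of_eq ?_)
  have h4 : (ρ.totalVariation Set.univ).toReal ^ 2 * (4 * S) =
      (2 * (ρ.totalVariation Set.univ).toReal) ^ 2 * S := by ring
  rw [h4, Real.sqrt_mul (by positivity), Real.sqrt_sq (by positivity)]
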